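/- (Robust counterpart of the epigraph constraint under the affine decision rule.) Let T ≥ 2, α_1, …, α_T ∈ ℝ, β_2, …, β_T ∈ ℝ, and Ω ∈ ℝ. The robust constraint '∑_{t=1}^T α_t + ∑_{t=2}^T β_t·l_{t−1} ≤ Ω for all l ∈ U^CLT' holds if and only if there exist s₁, s₂ ≥ 0 with s₁ − s₂ ≥ β_t for all 2 ≤ t ≤ T, s₁ − s₂ ≥ 0, and ∑_{t=1}^T α_t + (T·m̄ + γ₂·σ·√T)·s₁ + (γ₂·σ·√T − T·m̄)·s₂ ≤ Ω. -/

import Mathlib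

/-- The CLT uncertainty set: losses `l : {1,…,T} → ℝ` with `l t ≥ 0` and
`|∑_{t=1}^T l t − T·m̄| ≤ γ₂·σ·√T`. -/
def UCLT (T : ℕ) (m σ γ₂ : ℝ) (l : ℕ → ℝ) : Prop :=
  (∀ t ∈ Finset.Icc 1 T, 0 ≤ l t) ∧
    |(∑ t ∈ Finset.Icc 1 T, l t) - (T : ℝ) * m| ≤ γ₂ * σ * Real.sqrt T

/-- Concentrating the largest admissible total loss in a single period is admissible. -/
theorem UCLT_single {T : ℕ} {m σ γ₂ : ℝ} (hm : 0 ≤ m) (hσ : 0 ≤ σ) (hγ : 0 ≤ γ₂) {k : ℕ}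
    (hk : k ∈ Finset.Icc 1 T) :
    UCLT T m σ γ₂ (Pi.single k ((T : ℝ) * m + γ₂ * σ * Real.sqrt T)) := by
  have he : 0 ≤ γ₂ * σ * Real.sqrt T := by positivity
  have hL : 0 ≤ (T : ℝ) * m + γ₂ * σ * Real.sqrt T := by positivity
  have hsingle : (0 : ℕ → ℝ) ≤ Pi.single k ((T : ℝ) * m + γ₂ * σ * Real.sqrt T) :=
    Pi.single_nonneg.mpr hL
  refine ⟨fun t _ => hsingle t, ?_⟩
  rw [Finset.sum_pi_single', if_pos hk, add_sub_cancel_left, abs_of_nonneg he]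

/-- Shifting the index of the lagged loss. -/
theorem sum_Icc_two_pred (T : ℕ) (l : ℕ → ℝ) :
    ∑ t ∈ Finset.Icc 2 T, l (t - 1) = ∑ t ∈ Finset.Icc 1 (T - 1), l t := by
  refine Finset.sum_bij' (fun t _ => t - 1) (fun t _ => t + 1) ?_ ?_ ?_ ?_ ?_ <;>
    simp only [Finset.mem_Icc] <;> intros <;> first | rfl | lia

/-- (Robust counterpart of the epigraph constraint under the affine decision rule.)
The robust constraint `∑ α + ∑_{t=2}^T β t · l (t−1) ≤ Ω` for all `l ∈ U^CLT` holds
iff a dual certificate `(s₁, s₂)` exists. -/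
theorem aro_epigraph_robust_counterpart (T : ℕ) (hT2 : 2 ≤ T) (m σ γ₂ : ℝ)
    (hm : 0 ≤ m) (hσ : 0 ≤ σ) (hγ : 0 ≤ γ₂) (α β : ℕ → ℝ) (Ω : ℝ) :
    (∀ l : ℕ → ℝ, UCLT T m σ γ₂ l →
        (∑ t ∈ Finset.Icc 1 T, α t) + (∑ t ∈ Finset.Icc 2 T, β t * l (t - 1)) ≤ Ω) ↔
      (∃ s₁ s₂ : ℝ, 0 ≤ s₁ ∧ 0 ≤ s₂ ∧
        (∀ t ∈ Finset.Icc 2 T, s₁ - s₂ ≥ β t) ∧ s₁ - s₂ ≥ 0 ∧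
        (∑ t ∈ Finset.Icc 1 T, α t) +
            ((T : ℝ) * m + γ₂ * σ * Real.sqrt T) * s₁ +
            (γ₂ * σ * Real.sqrt T - (T : ℝ) * m) * s₂ ≤ Ω) := by
  constructor
  · intro h
    obtain ⟨k, hk, hmax⟩ := Finset.exists_max_image (Finset.Icc 2 T) β
      ⟨2, Finset.mem_Icc.mpr ⟨le_rfl, hT2⟩⟩
    refine ⟨max (β k) 0, 0, le_max_right _ _, le_rfl, fun t ht => ?_, ?_, ?_⟩
    · simpa using Or.inl (hmax t ht)
    · simp
    · rw [Finset.mem_Icc] at hk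
      rcases le_total 0 (β k) with hβ | hβ
      · have hs := h _ (UCLT_single hm hσ hγ (k := k - 1) (Finset.mem_Icc.mpr (by lia)))
        rw [Finset.sum_eq_single (s := Finset.Icc 2 T) k] at hs
        · rw [Pi.single_eq_same] at hs
          rw [max_eq_left hβ]
          linarith
        · intro t ht htk
          rw [Finset.mem_Icc] at ht
          rw [Pi.single_eq_of_ne (by lia), mul_zero]
        · intro hn
          exact absurd (Finset.mem_Icc.mpr hk) hn
      · have hs := h _ (UCLT_single hm hσ hγ (k := T) (Finset.mem_Icc.mpr (by lia)))
        rw [Finset.sum_eq_zero (s := Finset.Icc 2 T)] at hs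
        · rw [max_eq_right hβ]
          linarith
        · intro t ht
          rw [Finset.mem_Icc] at ht
          rw [Pi.single_eq_of_ne (by lia), mul_zero]
  · rintro ⟨s₁, s₂, h₁, h₂, hβ, hs, hΩ⟩ l ⟨hl, habs⟩
    have hsum : ∑ t ∈ Finset.Icc 2 T, β t * l (t - 1) ≤
        (s₁ - s₂) * ∑ t ∈ Finset.Icc 1 T, l t := by
      calc ∑ t ∈ Finset.Icc 2 T, β t * l (t - 1)
          ≤ ∑ t ∈ Finset.Icc 2 T, (s₁ - s₂) * l (t - 1) := by
            refine Finset.sum_le_sum fun t ht => mul_le_mul_of_nonneg_right (hβ t ht) (hl _ ?_)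
            rw [Finset.mem_Icc] at ht ⊢
            lia
        _ = (s₁ - s₂) * ∑ t ∈ Finset.Icc 1 (T - 1), l t := by
            rw [← Finset.mul_sum, sum_Icc_two_pred]
        _ ≤ (s₁ - s₂) * ∑ t ∈ Finset.Icc 1 T, l t := by
            refine mul_le_mul_of_nonneg_left ?_ hs
            exact Finset.sum_le_sum_of_subset_of_nonneg
              (Finset.Icc_subset_Icc_right (Nat.sub_le T 1)) fun t ht _ => hl t ht
    obtain ⟨hlo, hhi⟩ := abs_le.mp habs
    linarith [mul_le_mul_of_nonneg_left hhi h₁, mul_le_mul_of_nonneg_left hlo h₂]
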